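/- Let A be an algebra, S and T tolerances on A, and δ a congruence on A. Then C(S,T;δ) holds if and only if C(S, δ∘T∘δ; δ) holds, where ∘ denotes composition of binary relations. -/

import Mathlib

open FirstOrder.Language FirstOrder.Language.Structure

universe u v w

/-- A binary relation on `A` is compatible with all (interpreted) operations of the
`L`-structure `A`. -/
def Compatible (L : FirstOrder.Language.{u, v}) (A : Type w) [L.Structure A]
    (T : A → A → Prop) : Prop :=
  ∀ (n : ℕ) (f : L.Functions n) (a b : Fin n → A),
    (∀ i, T (a i) (b i)) → T (funMap f a) (funMap f b)

/-- A tolerance on `A`: a reflexive, symmetric, compatible binary relation. -/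
def IsTolerance (L : FirstOrder.Language.{u, v}) (A : Type w) [L.Structure A]
    (T : A → A → Prop) : Prop :=
  Reflexive T ∧ Symmetric T ∧ Compatible L A T

/-- A congruence on `A`: a transitive tolerance. -/
def IsCongruence (L : FirstOrder.Language.{u, v}) (A : Type w) [L.Structure A]
    (T : A → A → Prop) : Prop :=
  IsTolerance L A T ∧ Transitive T

/-- The centralizer condition `C(S, T; δ)`: for every term `t(x, y₁, …, yₙ)`
(variable `0` playing the role of `x`), every `(a, b) ∈ S` and all pairs
`(uᵢ, vᵢ) ∈ T`, if `(t(a, ū), t(a, v̄)) ∈ δ` then `(t(b, ū), t(b, v̄)) ∈ δ`. -/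
def Centralizes (L : FirstOrder.Language.{u, v}) (A : Type w) [L.Structure A]
    (S T δ : A → A → Prop) : Prop :=
  ∀ (n : ℕ) (t : L.Term (Fin (n + 1))) (a b : A), S a b →
    ∀ u v : Fin n → A, (∀ i, T (u i) (v i)) →
      (δ (t.realize (Fin.cons a u)) (t.realize (Fin.cons a v)) →
        δ (t.realize (Fin.cons b u)) (t.realize (Fin.cons b v)))

/-- Composition of binary relations: `(a, c) ∈ R ∘ S` iff there is `b` with
`(a, b) ∈ R` and `(b, c) ∈ S`. -/
def RelComp {A : Type w} (R S : A → A → Prop) : A → A → Prop :=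
  fun a c => ∃ b, R a b ∧ S b c

theorem IsTolerance.realize {L : FirstOrder.Language.{u, v}} {A : Type w} [L.Structure A]
    {T : A → A → Prop} (hT : IsTolerance L A T) {α : Type*} (t : L.Term α) {x y : α → A}
    (h : ∀ i, T (x i) (y i)) : T (t.realize x) (t.realize y) := by
  induction t with
  | var i => exact h i
  | func f ts ih => exact hT.2.2 _ f _ _ ih

theorem IsTolerance.realize_cons {L : FirstOrder.Language.{u, v}} {A : Type w} [L.Structure A]
    {T : A → A → Prop} (hT : IsTolerance L A T) {n : ℕ} (t : L.Term (Fin (n + 1))) (a : A)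
    {x y : Fin n → A} (h : ∀ i, T (x i) (y i)) :
    T (t.realize (Fin.cons a x)) (t.realize (Fin.cons a y)) :=
  hT.realize t (Fin.cases (hT.1 a) h)

/-- Theorem 2.19 (3): `C(S, T; δ)` holds if and only if `C(S, δ ∘ T ∘ δ; δ)`
holds. -/
theorem centralizes_comp_iff {L : FirstOrder.Language.{u, v}}
    {A : Type w} [L.Structure A] (S T δ : A → A → Prop)
    (hS : IsTolerance L A S) (hT : IsTolerance L A T) (hδ : IsCongruence L A δ) :
    Centralizes L A S T δ ↔ Centralizes L A S (RelComp (RelComp δ T) δ) δ := by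
  constructor
  · intro h n t a b hab u v huv ht
    choose v' huv' hv using huv
    choose u' hu huv' using huv'
    have symm {x y : A} (hxy : δ x y) : δ y x := hδ.1.2.1 hxy
    have trans {x y z : A} (hxy : δ x y) (hyz : δ y z) : δ x z := hδ.2 hxy hyz
    have hu_realize (c : A) := hδ.1.realize_cons t c hu
    have hv_realize (c : A) := hδ.1.realize_cons t c hv
    have key := h n t a b hab u' v' huv'
      (trans (symm (hu_realize a)) (trans ht (symm (hv_realize a))))
    exact trans (hu_realize b) (trans key (hv_realize b))
  · intro h n t a b hab u v huv
    exact h n t a b hab u v fun i => ⟨v i, ⟨u i, hδ.1.1 _, huv i⟩, hδ.1.1 _⟩
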